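/- arXiv:2208.08396 — 4 statements merged into one kernel-verified Lean document; each statement's English description precedes it below -/
import Mathlib

section
/- (Proposition on shifted B(∞), part (1).) For every h ∈ ℋ_𝐢, every x ∈ ℤ^N and every i ∈ I occurring in 𝐢, one has ẽ_i(x + h) = ẽ_i(x) + h and f̃_i(x + h) = f̃_i(x) + h, where + denotes coordinatewise addition on ℤ^N. -/
/-- `σ_k(x) = x_k + Σ_{j<k} a_{i_k i_j} x_j` on the cellular crystal `𝔹_𝐢 ≅ ℤ^N`. -/
def sig {n N : ℕ} (A : Fin n → Fin n → ℤ) (ii : Fin N → Fin n)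
    (x : Fin N → ℤ) (k : Fin N) : ℤ :=
  x k + ∑ j ∈ Finset.univ.filter (fun j => j < k), A (ii k) (ii j) * x j

/-- `l = k⁺`: the least index `l > k` with the same color `i_l = i_k`. -/
def IsKPlus {n N : ℕ} (ii : Fin N → Fin n) (k l : Fin N) : Prop :=
  k < l ∧ ii l = ii k ∧ ∀ j : Fin N, k < j → ii j = ii k → l ≤ j

/-- `β_k(x) = x_k + Σ_{k<j<k⁺} a_{i_k i_j} x_j + x_{k⁺}` (with `l = k⁺`). -/
def betaFn {n N : ℕ} (A : Fin n → Fin n → ℤ) (ii : Fin N → Fin n)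
    (x : Fin N → ℤ) (k l : Fin N) : ℤ :=
  x k + ∑ j ∈ Finset.univ.filter (fun j => k < j ∧ j < l), A (ii k) (ii j) * x j + x l

/-- `ℋ_𝐢 = {h ∈ ℤ^N : β_k(h) = 0 whenever k⁺ exists}`. -/
def Hset {n N : ℕ} (A : Fin n → Fin n → ℤ) (ii : Fin N → Fin n) : Set (Fin N → ℤ) :=
  {h | ∀ k l : Fin N, IsKPlus ii k l → betaFn A ii h k l = 0}

/-- The set of positions of color `i` in the word `𝐢`. -/
def occ {n N : ℕ} (ii : Fin N → Fin n) (i : Fin n) : Finset (Fin N) :=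
  Finset.univ.filter (fun k => ii k = i)

/-- `σ̃_i(x) = max{σ_k(x) : i_k = i}` (junk value `0` if `i` does not occur in `𝐢`). -/
def sigTilde {n N : ℕ} (A : Fin n → Fin n → ℤ) (ii : Fin N → Fin n)
    (i : Fin n) (x : Fin N → ℤ) : ℤ :=
  if h : (occ ii i).Nonempty then (occ ii i).sup' h (sig A ii x) else 0

/-- The set of positions `k` of color `i` where `σ_k(x)` attains the maximum `σ̃_i(x)`. -/
def Mset {n N : ℕ} (A : Fin n → Fin n → ℤ) (ii : Fin N → Fin n)
    (i : Fin n) (x : Fin N → ℤ) : Finset (Fin N) :=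
  (occ ii i).filter (fun k => sig A ii x k = sigTilde A ii i x)

/-- The Kashiwara operator `f̃_i` on `𝔹_𝐢 ≅ ℤ^N`: add `1` at position `m̃ᶠ_i(x)`,
the largest maximizer of `σ` among positions of color `i`. -/
def ftilde {n N : ℕ} (A : Fin n → Fin n → ℤ) (ii : Fin N → Fin n)
    (i : Fin n) (x : Fin N → ℤ) : Fin N → ℤ :=
  if h : (Mset A ii i x).Nonempty then
    Function.update x ((Mset A ii i x).max' h) (x ((Mset A ii i x).max' h) + 1)
  else x

/-- The Kashiwara operator `ẽ_i` on `𝔹_𝐢 ≅ ℤ^N`: subtract `1` at position `m̃ᵉ_i(x)`,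
the smallest maximizer of `σ` among positions of color `i`. -/
def etilde {n N : ℕ} (A : Fin n → Fin n → ℤ) (ii : Fin N → Fin n)
    (i : Fin n) (x : Fin N → ℤ) : Fin N → ℤ :=
  if h : (Mset A ii i x).Nonempty then
    Function.update x ((Mset A ii i x).min' h) (x ((Mset A ii i x).min' h) - 1)
  else x

theorem sig_add {n N : ℕ} (A : Fin n → Fin n → ℤ) (ii : Fin N → Fin n)
    (x y : Fin N → ℤ) (k : Fin N) :
    sig A ii (x + y) k = sig A ii x k + sig A ii y k := by
  simp only [sig, Pi.add_apply, mul_add, Finset.sum_add_distrib]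
  ring

theorem sig_eq_add_betaFn {n N : ℕ} (A : Fin n → Fin n → ℤ) (hA2 : ∀ p, A p p = 2)
    (ii : Fin N → Fin n) (x : Fin N → ℤ) {k l : Fin N} (hkl : k < l) (hii : ii l = ii k) :
    sig A ii x l = sig A ii x k + betaFn A ii x k l := by
  have hsplit : Finset.univ.filter (fun j : Fin N => j < l) =
      (Finset.univ.filter (fun j => j < k)) ∪
        insert k (Finset.univ.filter (fun j => k < j ∧ j < l)) := by
    ext j
    simp only [Finset.mem_filter, Finset.mem_univ, true_and, Finset.mem_union, Finset.mem_insert]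
    omega
  have hdisj : Disjoint (Finset.univ.filter (fun j : Fin N => j < k))
      (insert k (Finset.univ.filter (fun j => k < j ∧ j < l))) := by
    rw [Finset.disjoint_left]
    intro j
    simp only [Finset.mem_filter, Finset.mem_univ, true_and, Finset.mem_insert]
    omega
  unfold sig betaFn
  rw [hii, hsplit, Finset.sum_union hdisj, Finset.sum_insert (by simp), hA2]
  ring

theorem sig_eq_of_mem_Hset {n N : ℕ} {A : Fin n → Fin n → ℤ} (hA2 : ∀ p, A p p = 2)
    {ii : Fin N → Fin n} {h : Fin N → ℤ} (hH : h ∈ Hset A ii) {k l : Fin N}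
    (hii : ii l = ii k) : sig A ii h l = sig A ii h k := by
  wlog hkl : k < l generalizing k l
  · rcases (not_lt.mp hkl).eq_or_lt with rfl | hlk
    · rfl
    · exact (this hii.symm hlk).symm
  induction l using WellFoundedLT.induction with
  | ind l ih =>
    obtain ⟨m, hm, hmax⟩ : ∃ m, (k ≤ m ∧ m < l ∧ ii m = ii k) ∧
        ∀ j, k ≤ j → j < l → ii j = ii k → j ≤ m := by
      let S := Finset.univ.filter (fun m : Fin N => k ≤ m ∧ m < l ∧ ii m = ii k)
      have hS : S.Nonempty := ⟨k, by simp [S, hkl]⟩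
      refine ⟨S.max' hS, ?_, fun j h1 h2 h3 => S.le_max' j (by simp [S, h1, h2, h3])⟩
      simpa [S] using S.max'_mem hS
    obtain ⟨hkm, hml, hmk⟩ := hm
    have hplus : IsKPlus ii m l := by
      refine ⟨hml, hii.trans hmk.symm, fun j hmj hj => ?_⟩
      by_contra! hjl
      exact absurd (hmax j (hkm.trans hmj.le) hjl (hj.trans hmk)) (not_le.mpr hmj)
    have hstep : sig A ii h l = sig A ii h m := by
      rw [sig_eq_add_betaFn A hA2 ii h hml (hii.trans hmk.symm), hH m l hplus, add_zero]
    rcases hkm.eq_or_lt with rfl | hkm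
    · exact hstep
    · exact hstep.trans (ih m hml hmk hkm)

theorem mem_Mset_iff {n N : ℕ} (A : Fin n → Fin n → ℤ) (ii : Fin N → Fin n)
    (i : Fin n) (x : Fin N → ℤ) (k : Fin N) :
    k ∈ Mset A ii i x ↔ ii k = i ∧ ∀ j, ii j = i → sig A ii x j ≤ sig A ii x k := by
  simp only [Mset, Finset.mem_filter]
  have hocc : ∀ j, j ∈ occ ii i ↔ ii j = i := fun j => by simp [occ]
  rw [hocc]
  refine and_congr_right fun hk => ?_
  have hne : (occ ii i).Nonempty := ⟨k, (hocc k).mpr hk⟩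
  rw [sigTilde, dif_pos hne]
  constructor
  · intro hmax j hj
    rw [hmax]
    exact Finset.le_sup' _ ((hocc j).mpr hj)
  · intro hmax
    exact le_antisymm (Finset.le_sup' _ ((hocc k).mpr hk))
      (Finset.sup'_le _ _ fun j hj => hmax j ((hocc j).mp hj))

theorem Mset_add_of_mem_Hset {n N : ℕ} {A : Fin n → Fin n → ℤ} (hA2 : ∀ p, A p p = 2)
    {ii : Fin N → Fin n} {h : Fin N → ℤ} (hH : h ∈ Hset A ii) (x : Fin N → ℤ) (i : Fin n) :
    Mset A ii i (x + h) = Mset A ii i x := by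
  ext k
  simp only [mem_Mset_iff, sig_add]
  refine and_congr_right fun hk => forall₂_congr fun j hj => ?_
  rw [sig_eq_of_mem_Hset hA2 hH (hj.trans hk.symm), add_le_add_iff_right]

theorem update_add_left {ι : Type*} [DecidableEq ι] (x h : ι → ℤ) (m : ι) (c : ℤ) :
    Function.update (x + h) m ((x + h) m + c) = Function.update x m (x m + c) + h := by
  ext j
  by_cases hj : j = m
  · subst hj
    simp only [Function.update_self, Pi.add_apply]
    ring
  · simp [Function.update_of_ne hj]

/-- for every `h ∈ ℋ_𝐢`, every `x ∈ ℤ^N` and every color `i` occurring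
in `𝐢`, one has `ẽ_i(x + h) = ẽ_i(x) + h` and `f̃_i(x + h) = f̃_i(x) + h`. -/
theorem etilde_ftilde_add_Hset
    (n N : ℕ) (hn : 1 ≤ n) (hN : 1 ≤ N)
    (A : Fin n → Fin n → ℤ)
    (hA2 : ∀ p, A p p = 2)
    (hAle : ∀ p q, p ≠ q → A p q ≤ 0)
    (hAzero : ∀ p q, A p q = 0 ↔ A q p = 0)
    (ii : Fin N → Fin n) (h : Fin N → ℤ) (hH : h ∈ Hset A ii)
    (x : Fin N → ℤ) (i : Fin n) (hocc : ∃ k, ii k = i) :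
    etilde A ii i (x + h) = etilde A ii i x + h ∧
    ftilde A ii i (x + h) = ftilde A ii i x + h := by
  simp only [etilde, ftilde, Mset_add_of_mem_Hset hA2 hH, sub_eq_add_neg]
  constructor <;> split_ifs
  · exact update_add_left x h _ _
  · rfl
  · exact update_add_left x h _ _
  · rfl
end

section
/- For every h ∈ ℋ_𝐢, every x ∈ ℤ^N and every i ∈ I occurring in 𝐢 with least occurrence index k₁ (the smallest k with i_k = i), one has σ̃_i(x + h) = σ̃_i(x) + σ̃_i(h) and σ̃_i(h) = σ_{k₁}(h). Equivalently, ε_i(x + h) = ε_i(x) + ε_i(h) for the function ε_i = σ̃_i on the cellular crystal 𝔹_𝐢. -/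
theorem sig_sub_sig_eq_betaFn {n N : ℕ} {A : Fin n → Fin n → ℤ} (hA2 : ∀ p, A p p = 2)
    {ii : Fin N → Fin n} (x : Fin N → ℤ) {k l : Fin N} (hkl : IsKPlus ii k l) :
    sig A ii x l - sig A ii x k = betaFn A ii x k l := by
  obtain ⟨hlt, hc, -⟩ := hkl
  have hsplit : (Finset.univ.filter fun j => j < l) =
      insert k (Finset.univ.filter fun j => j < k) ∪
        Finset.univ.filter fun j => k < j ∧ j < l := by
    ext j
    simp only [Finset.mem_filter, Finset.mem_univ, true_and, Finset.mem_union,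
      Finset.mem_insert]
    omega
  have hdisj : Disjoint (insert k (Finset.univ.filter fun j => j < k))
      (Finset.univ.filter fun j => k < j ∧ j < l) := by
    rw [Finset.disjoint_left]
    intro j
    simp only [Finset.mem_filter, Finset.mem_univ, true_and, Finset.mem_insert]
    omega
  unfold sig betaFn
  rw [hsplit, Finset.sum_union hdisj, Finset.sum_insert (by simp), hc, hA2]
  ring

theorem exists_isKPlus_of_lt {n N : ℕ} {ii : Fin N → Fin n} {k l : Fin N}
    (hlt : k < l) (hc : ii k = ii l) : ∃ p, IsKPlus ii p l := by
  obtain ⟨p, hp, hmax⟩ := (Finset.univ.filter fun j => j < l ∧ ii j = ii l).exists_max_image id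
    ⟨k, by simp [hlt, hc]⟩
  simp only [Finset.mem_filter, Finset.mem_univ, true_and, id] at hp hmax
  refine ⟨p, hp.1, hp.2.symm, fun j hpj hj => ?_⟩
  by_contra! hjl
  exact absurd (hmax j ⟨hjl, hj.trans hp.2⟩) (not_le.mpr hpj)

theorem sig_eq_sig_first {n N : ℕ} {A : Fin n → Fin n → ℤ} (hA2 : ∀ p, A p p = 2)
    {ii : Fin N → Fin n} {h : Fin N → ℤ} (hH : h ∈ Hset A ii) {i : Fin n} {k₁ : Fin N}
    (hk₁ : ii k₁ = i) (hmin : ∀ j : Fin N, ii j = i → k₁ ≤ j) (k : Fin N) (hk : ii k = i) :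
    sig A ii h k = sig A ii h k₁ := by
  induction k using WellFoundedLT.induction with
  | ind k ih =>
    rcases (hmin k hk).eq_or_lt with rfl | hlt
    · rfl
    · obtain ⟨p, hp⟩ := exists_isKPlus_of_lt hlt (hk₁.trans hk.symm)
      have hβ := sig_sub_sig_eq_betaFn hA2 h hp
      rw [hH p k hp] at hβ
      rw [sub_eq_zero.mp hβ]
      exact ih p hp.1 (hp.2.1.symm.trans hk)

/-- for `h ∈ ℋ_𝐢`, `x ∈ ℤ^N` and a color `i` occurring in `𝐢` with least
occurrence index `k₁`, one has `σ̃_i(x + h) = σ̃_i(x) + σ̃_i(h)` and `σ̃_i(h) = σ_{k₁}(h)`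
(i.e. `ε_i(x + h) = ε_i(x) + ε_i(h)` for `ε_i = σ̃_i` on the cellular crystal). -/
theorem sigTilde_add_Hset
    (n N : ℕ) (hn : 1 ≤ n) (hN : 1 ≤ N)
    (A : Fin n → Fin n → ℤ)
    (hA2 : ∀ p, A p p = 2)
    (hAle : ∀ p q, p ≠ q → A p q ≤ 0)
    (hAzero : ∀ p q, A p q = 0 ↔ A q p = 0)
    (ii : Fin N → Fin n) (h : Fin N → ℤ) (hH : h ∈ Hset A ii)
    (x : Fin N → ℤ) (i : Fin n)
    (k1 : Fin N) (hk1 : ii k1 = i) (hk1min : ∀ j : Fin N, ii j = i → k1 ≤ j) :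
    sigTilde A ii i (x + h) = sigTilde A ii i x + sigTilde A ii i h ∧
    sigTilde A ii i h = sig A ii h k1 := by
  have hne : (occ ii i).Nonempty := ⟨k1, by simp [occ, hk1]⟩
  have hconst : ∀ k ∈ occ ii i, sig A ii h k = sig A ii h k1 := fun k hk =>
    sig_eq_sig_first hA2 hH hk1 hk1min k (by simpa [occ] using hk)
  have hh : sigTilde A ii i h = sig A ii h k1 := by
    rw [sigTilde, dif_pos hne, Finset.sup'_congr hne rfl hconst, Finset.sup'_const]
  refine ⟨?_, hh⟩
  rw [hh, sigTilde, sigTilde, dif_pos hne, dif_pos hne, Finset.sup'_add]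
  exact Finset.sup'_congr hne rfl fun k hk => by rw [sig_add, hconst k hk]
end

section
/- For every i ∈ I occurring in 𝐢 and every x ∈ ℤ^N, one has σ̃_i(f̃_i(x)) = σ̃_i(x) + 1 and σ̃_i(ẽ_i(x)) = σ̃_i(x) − 1; i.e. the function ε_i = σ̃_i on the cellular crystal satisfies the crystal axioms ε_i(f̃_i x) = ε_i(x) + 1 and ε_i(ẽ_i x) = ε_i(x) − 1. -/
theorem sig_update {n N : ℕ} (A : Fin n → Fin n → ℤ) (ii : Fin N → Fin n)
    (x : Fin N → ℤ) (m k : Fin N) (c : ℤ) :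
    sig A ii (Function.update x m (x m + c)) k =
      sig A ii x k + (if k = m then c else 0) + (if m < k then A (ii k) (ii m) * c else 0) := by
  have hupd : ∀ j, Function.update x m (x m + c) j = x j + if j = m then c else 0 := by
    intro j
    by_cases h : j = m
    · subst h; simp
    · simp [h]
  simp only [sig, hupd, mul_add, Finset.sum_add_distrib, mul_ite, mul_zero, Finset.sum_ite_eq',
    Finset.mem_filter, Finset.mem_univ, true_and]
  ring

theorem sig_le_sigTilde {n N : ℕ} (A : Fin n → Fin n → ℤ) (ii : Fin N → Fin n)
    (x : Fin N → ℤ) (k : Fin N) : sig A ii x k ≤ sigTilde A ii (ii k) x := by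
  have hk : k ∈ occ ii (ii k) := by simp [occ]
  rw [sigTilde, dif_pos ⟨k, hk⟩]
  exact Finset.le_sup' _ hk

theorem sigTilde_eq_of_forall_le {n N : ℕ} (A : Fin n → Fin n → ℤ) (ii : Fin N → Fin n)
    {i : Fin n} (x : Fin N → ℤ) {m : Fin N} {v : ℤ} (hm : ii m = i) (hv : sig A ii x m = v)
    (hle : ∀ k, ii k = i → sig A ii x k ≤ v) : sigTilde A ii i x = v := by
  have hmem : m ∈ occ ii i := by simp [occ, hm]
  refine le_antisymm ?_ ?_
  · rw [sigTilde, dif_pos ⟨m, hmem⟩]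
    exact Finset.sup'_le _ _ fun k hk => hle k (by simpa [occ] using hk)
  · rw [← hv, ← hm]
    exact sig_le_sigTilde A ii x m

theorem mem_Mset {n N : ℕ} {A : Fin n → Fin n → ℤ} {ii : Fin N → Fin n}
    {i : Fin n} {x : Fin N → ℤ} {k : Fin N} :
    k ∈ Mset A ii i x ↔ ii k = i ∧ sig A ii x k = sigTilde A ii i x := by
  simp [Mset, occ]

theorem Mset_nonempty {n N : ℕ} (A : Fin n → Fin n → ℤ) (ii : Fin N → Fin n)
    {i : Fin n} (hocc : ∃ k, ii k = i) (x : Fin N → ℤ) : (Mset A ii i x).Nonempty := by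
  obtain ⟨k₀, hk₀⟩ := hocc
  have hne : (occ ii i).Nonempty := ⟨k₀, by simp [occ, hk₀]⟩
  obtain ⟨k, hk, hmax⟩ := Finset.exists_mem_eq_sup' hne (sig A ii x)
  refine ⟨k, mem_Mset.2 ⟨by simpa [occ] using hk, ?_⟩⟩
  rw [sigTilde, dif_pos hne, hmax]

/-- for every color `i` occurring in `𝐢` and every `x ∈ ℤ^N`, one has
`σ̃_i(f̃_i x) = σ̃_i(x) + 1` and `σ̃_i(ẽ_i x) = σ̃_i(x) − 1`; i.e. `ε_i = σ̃_i` satisfies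
the crystal axioms `ε_i(f̃_i x) = ε_i(x) + 1` and `ε_i(ẽ_i x) = ε_i(x) − 1`. -/
theorem sigTilde_ftilde_etilde
    (n N : ℕ) (hn : 1 ≤ n) (hN : 1 ≤ N)
    (A : Fin n → Fin n → ℤ)
    (hA2 : ∀ p, A p p = 2)
    (hAle : ∀ p q, p ≠ q → A p q ≤ 0)
    (hAzero : ∀ p q, A p q = 0 ↔ A q p = 0)
    (ii : Fin N → Fin n) (i : Fin n) (hocc : ∃ k, ii k = i) (x : Fin N → ℤ) :
    sigTilde A ii i (ftilde A ii i x) = sigTilde A ii i x + 1 ∧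
    sigTilde A ii i (etilde A ii i x) = sigTilde A ii i x - 1 := by
  have hne := Mset_nonempty A ii hocc x
  have hle : ∀ k, ii k = i → sig A ii x k ≤ sigTilde A ii i x := by
    rintro k rfl
    exact sig_le_sigTilde A ii x k
  constructor
  · rw [ftilde, dif_pos hne]
    obtain ⟨hm, hmσ⟩ := mem_Mset.1 (Finset.max'_mem _ hne)
    have hlast : ∀ k ∈ Mset A ii i x, k ≤ (Mset A ii i x).max' hne := Finset.le_max' _
    generalize (Mset A ii i x).max' hne = m at *
    refine sigTilde_eq_of_forall_le A ii _ hm (by simp [sig_update, hmσ]) fun k hk => ?_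
    have hlt : m < k → sig A ii x k ≠ sigTilde A ii i x := fun hmk h =>
      hmk.not_ge (hlast k (mem_Mset.2 ⟨hk, h⟩))
    have := hle k hk
    rw [sig_update, hk, hm, hA2]
    split_ifs <;> grind
  · rw [etilde, dif_pos hne]
    obtain ⟨hm, hmσ⟩ := mem_Mset.1 (Finset.min'_mem _ hne)
    have hfirst : ∀ k ∈ Mset A ii i x, (Mset A ii i x).min' hne ≤ k := Finset.min'_le _
    generalize (Mset A ii i x).min' hne = m at *
    simp only [sub_eq_add_neg]
    refine sigTilde_eq_of_forall_le A ii _ hm (by simp [sig_update, hmσ]) fun k hk => ?_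
    have hlt : k < m → sig A ii x k ≠ sigTilde A ii i x := fun hkm h =>
      hkm.not_ge (hfirst k (mem_Mset.2 ⟨hk, h⟩))
    have := hle k hk
    rw [sig_update, hk, hm, hA2]
    split_ifs <;> grind
end

section
/- (Well-definedness of the 4-move on ℋ.) Suppose 1 ≤ m and m + 3 ≤ N, with i_m = i_{m+2} = i, i_{m+1} = i_{m+3} = j, i ≠ j, and a_{ij}·a_{ji} = 2. Let 𝐢′ be the word obtained from 𝐢 by replacing the block (i_m, i_{m+1}, i_{m+2}, i_{m+3}) = (i, j, i, j) by (j, i, j, i), and let T : ℤ^N → ℤ^N be the map reversing the order of coordinates m,…,m + 3 (so T(h)_{m+r} = h_{m+3−r} for r = 0,…,3) and fixing all other coordinates. Then T restricts to a bijection from ℋ_𝐢 onto ℋ_{𝐢′}. -/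
/-- The weighted sum of the coordinates of `x` at positions below `t`, with the weights of the
color `c`. -/
def prefixSum {n N : ℕ} (A : Fin n → Fin n → ℤ) (ii : Fin N → Fin n)
    (x : Fin N → ℤ) (c : Fin n) (t : ℕ) : ℤ :=
  ∑ q ∈ Finset.univ.filter (fun q : Fin N => (q : ℕ) < t), A c (ii q) * x q

/-- The potential at `p`, whose difference between `k⁺` and `k` is `β_k`. -/
def potential {n N : ℕ} (A : Fin n → Fin n → ℤ) (ii : Fin N → Fin n)
    (x : Fin N → ℤ) (p : Fin N) : ℤ :=
  prefixSum A ii x (ii p) p + x p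

theorem prefixSum_succ {n N : ℕ} (A : Fin n → Fin n → ℤ) (ii : Fin N → Fin n)
    (x : Fin N → ℤ) (c : Fin n) (t : ℕ) (ht : t < N) :
    prefixSum A ii x c (t + 1) = prefixSum A ii x c t + A c (ii ⟨t, ht⟩) * x ⟨t, ht⟩ := by
  have hins : Finset.univ.filter (fun q : Fin N => (q : ℕ) < t + 1) =
      insert ⟨t, ht⟩ (Finset.univ.filter (fun q : Fin N => (q : ℕ) < t)) := by
    ext q
    simp only [Finset.mem_filter, Finset.mem_univ, true_and, Finset.mem_insert, Fin.ext_iff]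
    omega
  rw [prefixSum, hins, Finset.sum_insert (by simp), add_comm, prefixSum]

theorem betaFn_eq_potential_sub {n N : ℕ} (A : Fin n → Fin n → ℤ) (hA2 : ∀ p, A p p = 2)
    (ii : Fin N → Fin n) (x : Fin N → ℤ) {k l : Fin N} (hkl : k < l) (hc : ii l = ii k) :
    betaFn A ii x k l = potential A ii x l - potential A ii x k := by
  have hsplit : prefixSum A ii x (ii k) l = prefixSum A ii x (ii k) (k + 1) +
      ∑ q ∈ Finset.univ.filter (fun q => k < q ∧ q < l), A (ii k) (ii q) * x q := by
    rw [prefixSum, prefixSum, ← Finset.sum_union]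
    · congr 1
      ext q
      simp only [Finset.mem_filter, Finset.mem_univ, true_and, Finset.mem_union, Fin.lt_def]
        at hkl ⊢
      omega
    · rw [Finset.disjoint_left]
      intro q
      simp only [Finset.mem_filter, Finset.mem_univ, true_and, Fin.lt_def]
      omega
  rw [prefixSum_succ A ii x _ _ k.isLt, hA2] at hsplit
  rw [betaFn, potential, potential, hc, hsplit]
  ring

/-- `ℋ` consists of the vectors whose potential depends only on the color. -/
theorem mem_Hset_iff {n N : ℕ} (A : Fin n → Fin n → ℤ) (hA2 : ∀ p, A p p = 2)
    (ii : Fin N → Fin n) (x : Fin N → ℤ) :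
    x ∈ Hset A ii ↔ ∀ k l, ii l = ii k → potential A ii x l = potential A ii x k := by
  constructor
  · intro hx
    have hlt : ∀ l k : Fin N, k < l → ii l = ii k →
        potential A ii x l = potential A ii x k := by
      intro l
      induction l using WellFoundedLT.induction with
      | ind l ih =>
        intro k hkl hc
        obtain ⟨p, hp, hmax⟩ := Finset.exists_max_image
          (Finset.univ.filter (fun q => q < l ∧ ii q = ii k)) id ⟨k, by simp [hkl]⟩
        simp only [Finset.mem_filter, Finset.mem_univ, true_and, id] at hp hmax
        have hβ := hx p l ⟨hp.1, hc.trans hp.2.symm, fun q hpq hq => by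
          by_contra! hql
          exact absurd (hmax q ⟨hql, hq.trans hp.2⟩) (not_le.mpr hpq)⟩
        rw [betaFn_eq_potential_sub A hA2 ii x hp.1 (hc.trans hp.2.symm), sub_eq_zero] at hβ
        rcases (hmax k ⟨hkl, rfl⟩).eq_or_lt with h | h
        · rw [hβ, h]
        · rw [hβ, ih p hp.1 k h hp.2]
    intro k l hc
    rcases lt_trichotomy k l with h | h | h
    · exact hlt l k h hc
    · rw [h]
    · exact (hlt k l h hc.symm).symm
  · intro hx k l hkl
    rw [betaFn_eq_potential_sub A hA2 ii x hkl.1 hkl.2.1, hx k l hkl.2.1, sub_self]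

/-- The word obtained by writing `j, i, j, i` at the positions `m, …, m + 3`. -/
def fourMoveWord {n N : ℕ} (m : ℕ) (i j : Fin n) (ii : Fin N → Fin n) : Fin N → Fin n :=
  fun k =>
    if (k : ℕ) = m then j
    else if (k : ℕ) = m + 1 then i
    else if (k : ℕ) = m + 2 then j
    else if (k : ℕ) = m + 3 then i
    else ii k

/-- The map reversing the coordinates `m, …, m + 3`. -/
def fourMove {N : ℕ} (m : ℕ) (hm : m + 3 < N) (h : Fin N → ℤ) : Fin N → ℤ :=
  fun k =>
    if (k : ℕ) = m then h ⟨m + 3, by omega⟩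
    else if (k : ℕ) = m + 1 then h ⟨m + 2, by omega⟩
    else if (k : ℕ) = m + 2 then h ⟨m + 1, by omega⟩
    else if (k : ℕ) = m + 3 then h ⟨m, by omega⟩
    else h k

theorem fourMove_fourMove {N : ℕ} (m : ℕ) (hm : m + 3 < N) (h : Fin N → ℤ) :
    fourMove m hm (fourMove m hm h) = h := by
  funext k
  by_cases k0 : k = ⟨m, by omega⟩
  · subst k0
    simp [fourMove]
  by_cases k1 : k = ⟨m + 1, by omega⟩
  · subst k1
    simp [fourMove]
  by_cases k2 : k = ⟨m + 2, by omega⟩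
  · subst k2
    simp [fourMove]
  by_cases k3 : k = ⟨m + 3, by omega⟩
  · subst k3
    simp [fourMove]
  simp only [Fin.ext_iff] at k0 k1 k2 k3
  simp [fourMove, k0, k1, k2, k3]

theorem fourMoveWord_fourMoveWord {n N : ℕ} (m : ℕ) (hm : m + 3 < N) (i j : Fin n)
    (ii : Fin N → Fin n)
    (h0 : ii ⟨m, by omega⟩ = i) (h1 : ii ⟨m + 1, by omega⟩ = j)
    (h2 : ii ⟨m + 2, by omega⟩ = i) (h3 : ii ⟨m + 3, by omega⟩ = j) :
    fourMoveWord m j i (fourMoveWord m i j ii) = ii := by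
  funext k
  simp only [fourMoveWord]
  split_ifs with k0 k1 k2 k3
  · rw [← h0]; congr 1; exact Fin.ext k0.symm
  · rw [← h1]; congr 1; exact Fin.ext k1.symm
  · rw [← h2]; congr 1; exact Fin.ext k2.symm
  · rw [← h3]; congr 1; exact Fin.ext k3.symm
  · rfl

theorem fourMove_mapsTo {n N : ℕ} (A : Fin n → Fin n → ℤ) (hA2 : ∀ p, A p p = 2)
    (ii : Fin N → Fin n) (m : ℕ) (hm : m + 3 < N) (i j : Fin n)
    (hAij : A i j * A j i = 2)
    (h0 : ii ⟨m, by omega⟩ = i) (h1 : ii ⟨m + 1, by omega⟩ = j)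
    (h2 : ii ⟨m + 2, by omega⟩ = i) (h3 : ii ⟨m + 3, by omega⟩ = j) :
    Set.MapsTo (fourMove m hm) (Hset A ii) (Hset A (fourMoveWord m i j ii)) := by
  intro x hx
  rw [mem_Hset_iff A hA2] at hx ⊢
  have hS := prefixSum_succ A ii x
  have hS' := prefixSum_succ A (fourMoveWord m i j ii) (fourMove m hm x)
  have hlow : ∀ c, ∀ t ≤ m, prefixSum A (fourMoveWord m i j ii) (fourMove m hm x) c t =
      prefixSum A ii x c t := by
    intro c t ht
    refine Finset.sum_congr rfl fun q hq => ?_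
    simp only [Finset.mem_filter, Finset.mem_univ, true_and] at hq
    rw [fourMoveWord, fourMove]
    simp only [show (q : ℕ) ≠ m by omega, show (q : ℕ) ≠ m + 1 by omega,
      show (q : ℕ) ≠ m + 2 by omega, show (q : ℕ) ≠ m + 3 by omega, if_false]
  have w0 : fourMoveWord m i j ii ⟨m, by omega⟩ = j := by simp [fourMoveWord]
  have w1 : fourMoveWord m i j ii ⟨m + 1, by omega⟩ = i := by simp [fourMoveWord]
  have w2 : fourMoveWord m i j ii ⟨m + 2, by omega⟩ = j := by simp [fourMoveWord]
  have w3 : fourMoveWord m i j ii ⟨m + 3, by omega⟩ = i := by simp [fourMoveWord]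
  have y0 : fourMove m hm x ⟨m, by omega⟩ = x ⟨m + 3, by omega⟩ := by simp [fourMove]
  have y1 : fourMove m hm x ⟨m + 1, by omega⟩ = x ⟨m + 2, by omega⟩ := by simp [fourMove]
  have y2 : fourMove m hm x ⟨m + 2, by omega⟩ = x ⟨m + 1, by omega⟩ := by simp [fourMove]
  have y3 : fourMove m hm x ⟨m + 3, by omega⟩ = x ⟨m, by omega⟩ := by simp [fourMove]
  have s0 := fun c => hS c m (by omega)
  have s1 := fun c => hS c (m + 1) (by omega)
  have s2 := fun c => hS c (m + 2) (by omega)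
  have s3 := fun c => hS c (m + 3) (by omega)
  have s0' := fun c => hS' c m (by omega)
  have s1' := fun c => hS' c (m + 1) (by omega)
  have s2' := fun c => hS' c (m + 2) (by omega)
  have s3' := fun c => hS' c (m + 3) (by omega)
  simp only [h0, h1, h2, h3] at s0 s1 s2 s3
  simp only [w0, w1, w2, w3, y0, y1, y2, y3, hlow _ m le_rfl] at s0' s1' s2' s3'
  have hhigh : ∀ c t, m + 4 ≤ t → t ≤ N →
      prefixSum A (fourMoveWord m i j ii) (fourMove m hm x) c t = prefixSum A ii x c t := by
    intro c t ht
    induction t, ht using Nat.le_induction with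
    | base => intro _; linarith [s0 c, s1 c, s2 c, s3 c, s0' c, s1' c, s2' c, s3' c]
    | succ t ht ih =>
      intro htN
      rw [hS' c t htN, hS c t htN, ih (by omega)]
      simp [fourMoveWord, fourMove, show t ≠ m by omega, show t ≠ m + 1 by omega,
        show t ≠ m + 2 by omega, show t ≠ m + 3 by omega]
  have e02 := hx ⟨m, by omega⟩ ⟨m + 2, by omega⟩ (h2.trans h0.symm)
  have e13 := hx ⟨m + 1, by omega⟩ ⟨m + 3, by omega⟩ (h3.trans h1.symm)
  simp only [potential, h0, h1, h2, h3, s0, s1, s2, hA2] at e02 e13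
  have hpot : ∀ p : Fin N, ∃ q : Fin N, fourMoveWord m i j ii p = ii q ∧
      potential A (fourMoveWord m i j ii) (fourMove m hm x) p = potential A ii x q := by
    intro p
    by_cases p0 : p = ⟨m, by omega⟩
    · subst p0
      refine ⟨⟨m + 1, by omega⟩, by rw [w0, h1], ?_⟩
      simp only [potential, w0, h1, y0, s0, hlow _ m le_rfl]
      linear_combination e13 - A j i * e02 + x ⟨m + 1, by omega⟩ * hAij
    by_cases p1 : p = ⟨m + 1, by omega⟩
    · subst p1
      refine ⟨⟨m, by omega⟩, by rw [w1, h0], ?_⟩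
      simp only [potential, w1, h0, y1, s0']
      linear_combination A i j * e13 - e02 - x ⟨m + 2, by omega⟩ * hAij
    by_cases p2 : p = ⟨m + 2, by omega⟩
    · subst p2
      refine ⟨⟨m + 1, by omega⟩, by rw [w2, h1], ?_⟩
      simp only [potential, w2, h1, y2, s0, s0', s1', hA2]
      linear_combination 2 * e13 - A j i * e02 + x ⟨m + 1, by omega⟩ * hAij
    by_cases p3 : p = ⟨m + 3, by omega⟩
    · subst p3
      refine ⟨⟨m, by omega⟩, by rw [w3, h0], ?_⟩
      simp only [potential, w3, h0, y3, s0', s1', s2', hA2]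
      linear_combination A i j * e13 - x ⟨m + 2, by omega⟩ * hAij
    simp only [Fin.ext_iff] at p0 p1 p2 p3
    have hw : fourMoveWord m i j ii p = ii p := by simp [fourMoveWord, p0, p1, p2, p3]
    have hy : fourMove m hm x p = x p := by simp [fourMove, p0, p1, p2, p3]
    refine ⟨p, hw, ?_⟩
    rw [potential, potential, hw, hy]
    rcases le_or_gt (p : ℕ) m with hp | hp
    · rw [hlow _ _ hp]
    · rw [hhigh _ _ (by omega) p.isLt.le]
  intro k l hkl
  obtain ⟨k', hk, hk'⟩ := hpot k
  obtain ⟨l', hl, hl'⟩ := hpot l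
  rw [hk', hl']
  exact hx k' l' (by rw [← hk, ← hl, hkl])

/-- well-definedness of the 4-move on `ℋ`: if positions `m,…,m+3`
(0-based) of `𝐢` carry the colors `i, j, i, j` with `i ≠ j` and `a_{ij}·a_{ji} = 2`,
and `𝐢′` is obtained from `𝐢` by replacing the block `(i, j, i, j)` by `(j, i, j, i)`,
then the map `T` reversing the coordinates `m,…,m+3` restricts to a bijection from
`ℋ_𝐢` onto `ℋ_𝐢′`. -/
theorem four_move_Hset
    (n N : ℕ) (hn : 1 ≤ n)
    (A : Fin n → Fin n → ℤ)
    (hA2 : ∀ p, A p p = 2)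
    (hAle : ∀ p q, p ≠ q → A p q ≤ 0)
    (hAzero : ∀ p q, A p q = 0 ↔ A q p = 0)
    (ii : Fin N → Fin n) (m : ℕ) (hm : m + 4 ≤ N)
    (i j : Fin n) (hij : i ≠ j)
    (hAij : A i j * A j i = 2)
    (h0 : ii ⟨m, by omega⟩ = i) (h1 : ii ⟨m + 1, by omega⟩ = j)
    (h2 : ii ⟨m + 2, by omega⟩ = i) (h3 : ii ⟨m + 3, by omega⟩ = j) :
    Set.BijOn
      (fun h : Fin N → ℤ => fun k : Fin N =>
        if (k : ℕ) = m then h ⟨m + 3, by omega⟩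
        else if (k : ℕ) = m + 1 then h ⟨m + 2, by omega⟩
        else if (k : ℕ) = m + 2 then h ⟨m + 1, by omega⟩
        else if (k : ℕ) = m + 3 then h ⟨m, by omega⟩
        else h k)
      (Hset A ii)
      (Hset A (fun k : Fin N =>
        if (k : ℕ) = m then j
        else if (k : ℕ) = m + 1 then i
        else if (k : ℕ) = m + 2 then j
        else if (k : ℕ) = m + 3 then i
        else ii k)) := by
  have hback := fourMove_mapsTo A hA2 (fourMoveWord m i j ii) m hm j i
    (by rw [mul_comm, hAij]) (by simp [fourMoveWord]) (by simp [fourMoveWord])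
    (by simp [fourMoveWord]) (by simp [fourMoveWord])
  rw [fourMoveWord_fourMoveWord m hm i j ii h0 h1 h2 h3] at hback
  have hinv : Set.InvOn (fourMove m hm) (fourMove m hm) (Hset A ii)
      (Hset A (fourMoveWord m i j ii)) :=
    ⟨fun x _ => fourMove_fourMove m hm x, fun x _ => fourMove_fourMove m hm x⟩
  exact hinv.bijOn (fourMove_mapsTo A hA2 ii m hm i j hAij h0 h1 h2 h3) hback
end
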